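/- For every N ∈ ℕ, α > 0 and β > 0, the quenched pressure is differentiable in α and ∂A_N(α,β)/∂α = ln cosh β − ∑_{n=1}^∞ ((−1)^n/n) θ^n ⟨q_{1…n}²⟩_N, where θ = tanh β and the series converges absolutely. -/

import Mathlib

open scoped BigOperators

noncomputable section

/-- The Poisson probability mass function with mean `lam`. -/
def pois (lam : ℝ) (k : ℕ) : ℝ := Real.exp (-lam) * lam ^ k / (Nat.factorial k)

/-- The spin value (±1) attached to a Boolean opinion. -/
def spin (b : Bool) : ℝ := if b then 1 else -1

/-- Average of `f` over `p` families of `k` i.i.d. indices, each uniform on `Fin N`. -/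
def avgIdx (N : ℕ) (p k : ℕ) (f : (Fin p → Fin k → Fin N) → ℝ) : ℝ :=
  ((N : ℝ) ^ (p * k))⁻¹ * ∑ im : Fin p → Fin k → Fin N, f im

/-- The interaction sum `∑_{ν=1}^k σ_{i_ν^1} ⋯ σ_{i_ν^p}`; the Hamiltonian is its negative. -/
def intSum {N p k : ℕ} (im : Fin p → Fin k → Fin N) (σ : Fin N → Bool) : ℝ :=
  ∑ ν : Fin k, ∏ l : Fin p, spin (σ (im l ν))

/-- The diluted `p`-spin Hamiltonian `H = -∑_{ν=1}^k σ_{i_ν^1} ⋯ σ_{i_ν^p}`. -/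
def Hspin {N p k : ℕ} (im : Fin p → Fin k → Fin N) (σ : Fin N → Bool) : ℝ :=
  - intSum im σ

/-- Partition function `Z = ∑_σ e^{-β H(σ)}`. -/
def Zpart (β : ℝ) {N p k : ℕ} (im : Fin p → Fin k → Fin N) : ℝ :=
  ∑ σ : Fin N → Bool, Real.exp (β * intSum im σ)

/-- Cavity term `∑_{ν=1}^{k'} σ_{i_ν^1} ⋯ σ_{i_ν^q}` (with `q = p - 1` families). -/
def cavSum {N q k' : ℕ} (im' : Fin q → Fin k' → Fin N) (σ : Fin N → Bool) : ℝ :=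
  ∑ ν : Fin k', ∏ l : Fin q, spin (σ (im' l ν))

/-- Perturbed Boltzmann weight `exp(β(∑_ν σ_{i_ν^1}⋯σ_{i_ν^p} + ∑_ν σ_{i'_ν^1}⋯σ_{i'_ν^{q}}))`. -/
def wpert (β : ℝ) {N p k q k' : ℕ} (im : Fin p → Fin k → Fin N)
    (im' : Fin q → Fin k' → Fin N) (σ : Fin N → Bool) : ℝ :=
  Real.exp (β * (intSum im σ + cavSum im' σ))

/-- Perturbed partition function. -/
def Zpert (β : ℝ) {N p k q k' : ℕ} (im : Fin p → Fin k → Fin N)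
    (im' : Fin q → Fin k' → Fin N) : ℝ :=
  ∑ σ : Fin N → Bool, wpert β im im' σ

/-- Replicated (unperturbed) Boltzmann state `Ω(g)` on `s` replicas sharing the same disorder. -/
def OmegaB (β : ℝ) {N p k : ℕ} (im : Fin p → Fin k → Fin N)
    (s : ℕ) (g : (Fin s → Fin N → Bool) → ℝ) : ℝ :=
  (∑ σs : Fin s → Fin N → Bool, g σs * ∏ a : Fin s, Real.exp (β * intSum im (σs a))) /
    (Zpart β im) ^ s

/-- Replicated perturbed Boltzmann state `Ω̃_t(g)` on `s` replicas sharing the same disorder. -/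
def OmegaPert (β : ℝ) {N p k q k' : ℕ} (im : Fin p → Fin k → Fin N)
    (im' : Fin q → Fin k' → Fin N) (s : ℕ) (g : (Fin s → Fin N → Bool) → ℝ) : ℝ :=
  (∑ σs : Fin s → Fin N → Bool, g σs * ∏ a : Fin s, wpert β im im' (σs a)) /
    (Zpert β im im') ^ s

/-- Quenched expectation: the number of interaction terms is Poisson of mean `γ N` and the
`p` index families are i.i.d. uniform on `Fin N`. -/
def Equench (N p : ℕ) (γ : ℝ) (f : (k : ℕ) → (Fin p → Fin k → Fin N) → ℝ) : ℝ :=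
  ∑' k : ℕ, pois (γ * N) k * avgIdx N p k (fun im => f k im)

/-- Quenched expectation including the cavity randomness: the cavity term has a Poisson
number of terms of mean `2 γ t`, with `p - 1` independent uniform index families. -/
def EquenchCav (N p : ℕ) (γ t : ℝ)
    (f : (k : ℕ) → (Fin p → Fin k → Fin N) →
         (k' : ℕ) → (Fin (p - 1) → Fin k' → Fin N) → ℝ) : ℝ :=
  ∑' k : ℕ, pois (γ * N) k * avgIdx N p k (fun im =>
    ∑' k' : ℕ, pois (2 * γ * t) k' * avgIdx N (p - 1) k' (fun im' => f k im k' im'))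

/-- Quenched average of `ln Z_N`. -/
def ElnZ (N p : ℕ) (γ β : ℝ) : ℝ :=
  Equench N p γ (fun _ im => Real.log (Zpart β im))

/-- Quenched pressure `A_N = (1/N) E[ln Z_N]`. -/
def pressure (N p : ℕ) (γ β : ℝ) : ℝ :=
  (N : ℝ)⁻¹ * ElnZ N p γ β

/-- Cavity function `Ψ_N(t) = E[ln (Z_{N,t} / Z_N)]`. -/
def cavityFn (N p : ℕ) (γ β t : ℝ) : ℝ :=
  EquenchCav N p γ t (fun _ im _ im' => Real.log (Zpert β im im' / Zpart β im))

/-- The multi-overlap `q_{1…n} = (1/N) ∑_i σ_i^{(1)} ⋯ σ_i^{(n)}` of `n` replicas. -/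
def qOv (N n : ℕ) (σs : Fin n → Fin N → Bool) : ℝ :=
  (N : ℝ)⁻¹ * ∑ x : Fin N, ∏ a : Fin n, spin (σs a x)

/-- Total (quenched) average `⟨q_{1…n}^r⟩_N` of the `r`-th power of the `n`-replica overlap. -/
def qPowAvg (N p : ℕ) (γ β : ℝ) (n r : ℕ) : ℝ :=
  Equench N p γ (fun _ im => OmegaB β im n (fun σs => (qOv N n σs) ^ r))

/-- Perturbed total average `⟨q_{1…n}^r⟩_{N,t}` of the `r`-th power of the `n`-replica overlap. -/
def qPowAvgPert (N p : ℕ) (γ β t : ℝ) (n r : ℕ) : ℝ :=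
  EquenchCav N p γ t (fun _ im _ im' => OmegaPert β im im' n (fun σs => (qOv N n σs) ^ r))

end

/-- The exponential generating function of a sequence of at most geometric growth can be
differentiated term by term. -/
theorem hasDerivAt_tsum_pow_div_factorial_mul {f : ℕ → ℝ} {C D : ℝ}
    (hf : ∀ k, |f k| ≤ C * D ^ k) (x : ℝ) :
    (Summable fun k : ℕ => x ^ k / k.factorial * f k) ∧
    HasDerivAt (fun y : ℝ => ∑' k : ℕ, y ^ k / k.factorial * f k)
      (∑' k : ℕ, x ^ k / k.factorial * f (k + 1)) x := by
  have hsum : ∀ y : ℝ, Summable fun k : ℕ => y ^ k / k.factorial * f k := by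
    intro y
    refine .of_norm_bounded ((Real.summable_pow_div_factorial (|y| * D)).mul_left C) fun k => ?_
    rw [Real.norm_eq_abs, abs_mul, abs_div, abs_pow, Nat.abs_cast]
    calc |y| ^ k / k.factorial * |f k| ≤ |y| ^ k / k.factorial * (C * D ^ k) := by
          gcongr; exact hf k
      _ = C * ((|y| * D) ^ k / k.factorial) := by rw [mul_pow]; ring
  refine ⟨hsum x, ?_⟩
  have hsplit : (fun y : ℝ => ∑' k : ℕ, y ^ k / k.factorial * f k) =
      fun y => f 0 + ∑' k : ℕ, y ^ (k + 1) / (k + 1).factorial * f (k + 1) := by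
    funext y
    rw [(hsum y).tsum_eq_zero_add]
    simp
  rw [hsplit]
  refine HasDerivAt.const_add _ ?_
  have hx : x ∈ Metric.ball (0 : ℝ) (|x| + 1) := by simp
  have hu : Summable fun k : ℕ => C * D * (((|x| + 1) * D) ^ k / k.factorial) :=
    (Real.summable_pow_div_factorial _).mul_left _
  have hx_sum : Summable fun k : ℕ => x ^ (k + 1) / (k + 1).factorial * f (k + 1) :=
    (summable_nat_add_iff (f := fun k : ℕ => x ^ k / k.factorial * f k) 1).2 (hsum x)
  refine hasDerivAt_tsum_of_isPreconnected
    (g := fun (k : ℕ) (y : ℝ) => y ^ (k + 1) / (k + 1).factorial * f (k + 1))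
    (g' := fun (k : ℕ) (y : ℝ) => y ^ k / k.factorial * f (k + 1))
    hu Metric.isOpen_ball (convex_ball _ _).isPreconnected ?_ ?_ hx hx_sum hx
  · intro k y _
    have h := ((hasDerivAt_pow (k + 1) y).div_const ((k + 1).factorial : ℝ)).mul_const (f (k + 1))
    refine h.congr_deriv ?_
    rw [Nat.factorial_succ, Nat.add_sub_cancel]
    push_cast
    field_simp
  · intro k y hy
    have hy' : |y| ≤ |x| + 1 := by simpa using (Metric.mem_ball.1 hy).le
    rw [Real.norm_eq_abs, abs_mul, abs_div, abs_pow, Nat.abs_cast]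
    calc |y| ^ k / k.factorial * |f (k + 1)|
        ≤ (|x| + 1) ^ k / k.factorial * (C * D ^ (k + 1)) := by
          gcongr; exact hf (k + 1)
      _ = C * D * (((|x| + 1) * D) ^ k / k.factorial) := by rw [mul_pow]; ring

theorem pois_mul (x y : ℝ) (k : ℕ) :
    pois x k * y = Real.exp (-x) * (x ^ k / k.factorial * y) := by
  unfold pois; ring

theorem pois_nonneg {x : ℝ} (hx : 0 ≤ x) (k : ℕ) : 0 ≤ pois x k := by
  unfold pois; positivity

theorem hasSum_pois (x : ℝ) : HasSum (pois x) 1 := by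
  have h := (NormedSpace.expSeries_div_hasSum_exp x).mul_left (Real.exp (-x))
  rw [← Real.exp_eq_exp_ℝ, ← Real.exp_add, neg_add_cancel, Real.exp_zero] at h
  refine h.congr_fun ?_
  intro k
  unfold pois; ring

/-- Derivative of a Poisson expectation with respect to the mean. -/
theorem hasDerivAt_tsum_pois_mul {f : ℕ → ℝ} {C D : ℝ} (hf : ∀ k, |f k| ≤ C * D ^ k) (x : ℝ) :
    HasDerivAt (fun y : ℝ => ∑' k : ℕ, pois y k * f k)
      (∑' k : ℕ, pois x k * (f (k + 1) - f k)) x := by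
  obtain ⟨hs, hd⟩ := hasDerivAt_tsum_pow_div_factorial_mul hf x
  have hs' : Summable fun k : ℕ => x ^ k / k.factorial * f (k + 1) :=
    (hasDerivAt_tsum_pow_div_factorial_mul (f := fun k => f (k + 1)) (C := C * D) (D := D)
      (fun k => (hf (k + 1)).trans_eq (by ring)) x).1
  simp only [pois_mul, tsum_mul_left]
  simp only [mul_sub]
  rw [hs'.tsum_sub hs]
  refine ((hasDerivAt_neg x).exp.mul hd).congr_deriv ?_
  ring

theorem abs_le_mul_two_pow {f : ℕ → ℝ} {M : ℝ} (hf : ∀ k, |f (k + 1) - f k| ≤ M) (k : ℕ) :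
    |f k| ≤ (|f 0| + M) * 2 ^ k := by
  have hM : 0 ≤ M := (abs_nonneg _).trans (hf 0)
  have hlin : |f k| ≤ |f 0| + M * k := by
    induction k with
    | zero => simp
    | succ k ih =>
      have h := abs_sub_abs_le_abs_sub (f (k + 1)) (f k)
      have := hf k
      push_cast
      linarith
  have hk : (k : ℝ) ≤ 2 ^ k := by exact_mod_cast Nat.lt_two_pow_self.le
  have h1 : (1 : ℝ) ≤ 2 ^ k := one_le_pow₀ (by norm_num)
  calc |f k| ≤ |f 0| * 1 + M * k := by simpa using hlin
    _ ≤ |f 0| * 2 ^ k + M * 2 ^ k := by gcongr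
    _ = _ := by ring

theorem hasSum_avgIdx {N p k : ℕ} {f : ℕ → (Fin p → Fin k → Fin N) → ℝ}
    {g : (Fin p → Fin k → Fin N) → ℝ} (h : ∀ im, HasSum (fun n => f n im) (g im)) :
    HasSum (fun n => avgIdx N p k (f n)) (avgIdx N p k g) :=
  (hasSum_sum fun im _ => h im).mul_left _

theorem avgIdx_const_mul {N p k : ℕ} (c : ℝ) (f : (Fin p → Fin k → Fin N) → ℝ) :
    avgIdx N p k (fun im => c * f im) = c * avgIdx N p k f := by
  simp only [avgIdx, ← Finset.mul_sum]; ring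

theorem avgIdx_sub {N p k : ℕ} (f g : (Fin p → Fin k → Fin N) → ℝ) :
    avgIdx N p k (fun im => f im - g im) = avgIdx N p k f - avgIdx N p k g := by
  simp only [avgIdx, Finset.sum_sub_distrib, mul_sub]

theorem avgIdx_const {N : ℕ} (hN : 0 < N) (p k : ℕ) (c : ℝ) :
    avgIdx N p k (fun _ => c) = c := by
  have : (N : ℝ) ≠ 0 := by positivity
  simp only [avgIdx, Finset.sum_const, Finset.card_univ, Fintype.card_fun, Fintype.card_fin,
    nsmul_eq_mul]
  push_cast
  rw [← pow_mul, mul_comm k p, inv_mul_cancel_left₀ (by positivity)]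

theorem abs_avgIdx_le {N : ℕ} (hN : 0 < N) {p k : ℕ} {f : (Fin p → Fin k → Fin N) → ℝ} {c : ℝ}
    (hf : ∀ im, |f im| ≤ c) : |avgIdx N p k f| ≤ c := by
  rw [← avgIdx_const hN p k c]
  unfold avgIdx
  rw [abs_mul, abs_of_nonneg (by positivity : (0 : ℝ) ≤ ((N : ℝ) ^ (p * k))⁻¹)]
  gcongr
  exact (Finset.abs_sum_le_sum_abs _ _).trans (Finset.sum_le_sum fun im _ => hf im)

/-- Prepending one interaction term to a family of `k` interaction terms. -/
def consIdxEquiv (N p k : ℕ) :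
    (Fin p → Fin k → Fin N) × (Fin p → Fin N) ≃ (Fin p → Fin (k + 1) → Fin N) where
  toFun x := fun l => Fin.cons (x.2 l) (x.1 l)
  invFun im := (fun l => Fin.tail (im l), fun l => im l 0)
  left_inv x := by simp
  right_inv im := by simp

theorem avgIdx_succ {N p k : ℕ} (f : (Fin p → Fin (k + 1) → Fin N) → ℝ) :
    avgIdx N p (k + 1) f =
      avgIdx N p k fun im => ((N : ℝ) ^ p)⁻¹ * ∑ j, f (consIdxEquiv N p k (im, j)) := by
  unfold avgIdx
  rw [← Equiv.sum_comp (consIdxEquiv N p k) f, Fintype.sum_prod_type, ← Finset.mul_sum,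
    ← mul_assoc, ← mul_inv, mul_add, mul_one, pow_add]

/-- The one-replica Boltzmann average of the spin product `σ_{j_1} ⋯ σ_{j_r}`. -/
noncomputable def gibbsProd (β : ℝ) {N p k r : ℕ} (im : Fin p → Fin k → Fin N)
    (j : Fin r → Fin N) : ℝ :=
  (∑ σ : Fin N → Bool, (∏ l, spin (σ (j l))) * Real.exp (β * intSum im σ)) / Zpart β im

theorem spin_eq (b : Bool) : spin b = 1 ∨ spin b = -1 := by
  cases b <;> simp [spin]

theorem prod_spin_eq {ι : Type*} (s : Finset ι) (b : ι → Bool) :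
    ∏ i ∈ s, spin (b i) = 1 ∨ ∏ i ∈ s, spin (b i) = -1 := by
  classical
  induction s using Finset.induction_on with
  | empty => simp
  | insert a s ha ih =>
    rw [Finset.prod_insert ha]
    rcases spin_eq (b a) with h | h <;> rcases ih with h' | h' <;> simp [h, h']

theorem Zpart_pos (β : ℝ) {N p k : ℕ} (im : Fin p → Fin k → Fin N) : 0 < Zpart β im :=
  Finset.sum_pos (fun _ _ => Real.exp_pos _) Finset.univ_nonempty

theorem abs_gibbsProd_le (β : ℝ) {N p k r : ℕ} (im : Fin p → Fin k → Fin N)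
    (j : Fin r → Fin N) :
    |gibbsProd β im j| ≤ 1 := by
  unfold gibbsProd
  rw [abs_div, abs_of_pos (Zpart_pos β im), div_le_one (Zpart_pos β im)]
  refine (Finset.abs_sum_le_sum_abs _ _).trans (Finset.sum_le_sum fun σ _ => ?_)
  rcases prod_spin_eq Finset.univ (fun l => σ (j l)) with h | h <;> simp [h]

theorem exp_mul_eq_cosh_mul {β s : ℝ} (hs : s = 1 ∨ s = -1) :
    Real.exp (β * s) = Real.cosh β * (1 + Real.tanh β * s) := by
  have hc := (Real.cosh_pos β).ne'
  rw [Real.tanh_eq_sinh_div_cosh]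
  rcases hs with rfl | rfl
  · field_simp
    rw [Real.cosh_add_sinh]
  · field_simp
    rw [← Real.cosh_sub_sinh]; ring

theorem Zpart_cons (β : ℝ) {N p k : ℕ} (im : Fin p → Fin k → Fin N) (j : Fin p → Fin N) :
    Zpart β (consIdxEquiv N p k (im, j)) =
      Real.cosh β * (1 + Real.tanh β * gibbsProd β im j) * Zpart β im := by
  have hZ := (Zpart_pos β im).ne'
  have hint : ∀ σ : Fin N → Bool, intSum (consIdxEquiv N p k (im, j)) σ =
      (∏ l, spin (σ (j l))) + intSum im σ := by
    intro σ
    simp [intSum, consIdxEquiv, Fin.sum_univ_succ]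
  have hterm : ∀ σ : Fin N → Bool, Real.exp (β * intSum (consIdxEquiv N p k (im, j)) σ) =
      Real.cosh β * (Real.exp (β * intSum im σ) +
        Real.tanh β * ((∏ l, spin (σ (j l))) * Real.exp (β * intSum im σ))) := by
    intro σ
    rw [hint, mul_add, Real.exp_add, exp_mul_eq_cosh_mul (prod_spin_eq _ fun l => σ (j l))]
    ring
  unfold Zpart at hZ ⊢
  simp only [hterm, ← Finset.mul_sum, Finset.sum_add_distrib, gibbsProd, Zpart]
  field_simp

/-- The replicated average of the `r`-th power of the `n`-replica overlap is the average over
`r` uniform indices of the `n`-th power of the one-replica average of their spin product. -/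
theorem OmegaB_qOv_pow (β : ℝ) {N p k : ℕ} (im : Fin p → Fin k → Fin N) (n r : ℕ) :
    OmegaB β im n (fun σs => qOv N n σs ^ r) =
      ((N : ℝ) ^ r)⁻¹ * ∑ j : Fin r → Fin N, gibbsProd β im j ^ n := by
  have hq : ∀ σs : Fin n → Fin N → Bool, qOv N n σs ^ r =
      ((N : ℝ) ^ r)⁻¹ * ∑ j : Fin r → Fin N, ∏ a, ∏ l, spin (σs a (j l)) := by
    intro σs
    rw [qOv, mul_pow, Fintype.sum_pow, inv_pow]
    congr 1
    exact Finset.sum_congr rfl fun j _ => Finset.prod_comm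
  unfold OmegaB gibbsProd
  simp only [hq, div_pow, Fintype.sum_pow, Finset.prod_mul_distrib, ← Finset.sum_div, mul_assoc,
    Finset.sum_mul, ← Finset.mul_sum]
  rw [Finset.sum_comm, mul_div_assoc]

/-- The quenched average of `ln Z` at a fixed number `k` of interaction terms. -/
noncomputable def avgLogZ (N p : ℕ) (β : ℝ) (k : ℕ) : ℝ :=
  avgIdx N p k fun im => Real.log (Zpart β im)

/-- The quenched average of `q_{1…n}^r` at a fixed number `k` of interaction terms. -/
noncomputable def avgOverlap (N p : ℕ) (β : ℝ) (n r k : ℕ) : ℝ :=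
  avgIdx N p k fun im => OmegaB β im n fun σs => qOv N n σs ^ r

theorem inv_card_mul_sum_const {N : ℕ} (hN : 0 < N) (p : ℕ) (c : ℝ) :
    ((N : ℝ) ^ p)⁻¹ * ∑ _j : Fin p → Fin N, c = c := by
  have : (N : ℝ) ≠ 0 := by positivity
  simp [this]

theorem abs_avgOverlap_le {N : ℕ} (hN : 0 < N) (p : ℕ) (β : ℝ) (n r k : ℕ) :
    |avgOverlap N p β n r k| ≤ 1 := by
  refine abs_avgIdx_le hN fun im => ?_
  rw [OmegaB_qOv_pow, abs_mul, abs_of_nonneg (by positivity : (0 : ℝ) ≤ ((N : ℝ) ^ r)⁻¹),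
    ← inv_card_mul_sum_const hN r 1]
  gcongr
  refine (Finset.abs_sum_le_sum_abs _ _).trans (Finset.sum_le_sum fun j _ => ?_)
  rw [abs_pow]
  exact pow_le_one₀ (abs_nonneg _) (abs_gibbsProd_le β im j)

theorem hasSum_log_one_add {x : ℝ} (hx : |x| < 1) :
    HasSum (fun n : ℕ => (-1 : ℝ) ^ (n + 1) / ((n : ℝ) + 1) * x ^ (n + 1)) (-Real.log (1 + x)) := by
  have h := Real.hasSum_pow_div_log_of_abs_lt_one (x := -x) (by rwa [abs_neg])
  rw [sub_neg_eq_add] at h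
  refine h.congr_fun ?_
  intro n
  rw [neg_pow]; ring

theorem log_Zpart_cons (β : ℝ) {N p k : ℕ} (im : Fin p → Fin k → Fin N) (j : Fin p → Fin N) :
    HasSum (fun n : ℕ => (-1 : ℝ) ^ (n + 1) / ((n : ℝ) + 1) * Real.tanh β ^ (n + 1) *
        gibbsProd β im j ^ (n + 1))
      (Real.log (Real.cosh β) -
        (Real.log (Zpart β (consIdxEquiv N p k (im, j))) - Real.log (Zpart β im))) := by
  have hx : |Real.tanh β * gibbsProd β im j| < 1 := by
    rw [abs_mul]
    exact (mul_le_of_le_one_right (abs_nonneg _) (abs_gibbsProd_le β im j)).trans_lt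
      (Real.abs_tanh_lt_one β)
  have hpos : 0 < 1 + Real.tanh β * gibbsProd β im j := by
    linarith [(abs_lt.1 hx).1]
  convert hasSum_log_one_add hx using 1
  · funext n
    rw [mul_pow, mul_assoc]
  · rw [Zpart_cons, Real.log_mul (mul_pos (Real.cosh_pos β) hpos).ne' (Zpart_pos β im).ne',
      Real.log_mul (Real.cosh_pos β).ne' hpos.ne']
    ring

/-- The effect on the averaged `ln Z` of adding one interaction term. -/
theorem hasSum_avgLogZ_succ_sub {N : ℕ} (hN : 0 < N) (p : ℕ) (β : ℝ) (k : ℕ) :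
    HasSum (fun n : ℕ => (-1 : ℝ) ^ (n + 1) / ((n : ℝ) + 1) * Real.tanh β ^ (n + 1) *
        avgOverlap N p β (n + 1) p k)
      (Real.log (Real.cosh β) - (avgLogZ N p β (k + 1) - avgLogZ N p β k)) := by
  have h := hasSum_avgIdx fun im : Fin p → Fin k → Fin N =>
    (hasSum_sum fun j (_ : j ∈ Finset.univ) => log_Zpart_cons β im j).mul_left ((N : ℝ) ^ p)⁻¹
  convert h using 1
  · funext n
    rw [avgOverlap, ← avgIdx_const_mul]
    congr 1
    funext im
    rw [OmegaB_qOv_pow, ← Finset.mul_sum]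
    ring
  · simp only [Finset.sum_sub_distrib, mul_sub, inv_card_mul_sum_const hN, avgIdx_sub,
      avgIdx_const hN, avgLogZ, avgIdx_succ (k := k)]

theorem summable_abs_log_coeff {x : ℝ} (hx : |x| < 1) :
    Summable fun n : ℕ => |(-1 : ℝ) ^ (n + 1) / ((n : ℝ) + 1) * x ^ (n + 1)| := by
  refine (Real.hasSum_pow_div_log_of_abs_lt_one (x := |x|) (by rwa [abs_abs])).summable.congr ?_
  intro n
  rw [abs_mul, abs_div, abs_pow, abs_neg, abs_one, one_pow, abs_pow,
    abs_of_pos (by positivity : (0 : ℝ) < n + 1)]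
  ring

theorem abs_qPowAvg_le {N : ℕ} (hN : 0 < N) (p : ℕ) {γ : ℝ} (hγ : 0 ≤ γ) (β : ℝ) (n r : ℕ) :
    |qPowAvg N p γ β n r| ≤ 1 := by
  rw [← Real.norm_eq_abs]
  refine tsum_of_norm_bounded (hasSum_pois (γ * N)) fun k => ?_
  have h0 : 0 ≤ pois (γ * N) k := pois_nonneg (by positivity) k
  rw [norm_mul, Real.norm_of_nonneg h0]
  exact mul_le_of_le_one_right h0 (abs_avgOverlap_le hN p β n r k)

/-- Streaming of the pressure in the connectivity, for the diluted `p`-spin model. -/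
theorem pressure_hasDerivAt {N : ℕ} (hN : 0 < N) (p : ℕ) {γ : ℝ} (hγ : 0 ≤ γ) (β : ℝ) :
    (Summable fun n : ℕ => |(-1 : ℝ) ^ (n + 1) / ((n : ℝ) + 1) * Real.tanh β ^ (n + 1) *
        qPowAvg N p γ β (n + 1) p|) ∧
    HasDerivAt (fun a : ℝ => pressure N p a β)
      (Real.log (Real.cosh β) -
        ∑' n : ℕ, (-1 : ℝ) ^ (n + 1) / ((n : ℝ) + 1) * Real.tanh β ^ (n + 1) *
          qPowAvg N p γ β (n + 1) p) γ := by
  have hN' : (N : ℝ) ≠ 0 := by positivity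
  set c : ℕ → ℝ := fun n => (-1 : ℝ) ^ (n + 1) / ((n : ℝ) + 1) * Real.tanh β ^ (n + 1) with hc
  have hcs : Summable fun n => |c n| := summable_abs_log_coeff (Real.abs_tanh_lt_one β)
  have hP : ∀ k, 0 ≤ pois (γ * N) k := pois_nonneg (by positivity)
  refine ⟨hcs.of_nonneg_of_le (fun _ => abs_nonneg _) fun n => ?_, ?_⟩
  · rw [abs_mul]
    exact mul_le_of_le_one_right (abs_nonneg _) (abs_qPowAvg_le hN p hγ β _ _)
  have hsucc := hasSum_avgLogZ_succ_sub hN p β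
  have hle : ∀ k n, ‖c n * avgOverlap N p β (n + 1) p k‖ ≤ |c n| := fun k n => by
    rw [Real.norm_eq_abs, abs_mul]
    exact mul_le_of_le_one_right (abs_nonneg _) (abs_avgOverlap_le hN p β _ _ k)
  have hbound : ∀ k, |avgLogZ N p β (k + 1) - avgLogZ N p β k| ≤
      |Real.log (Real.cosh β)| + ∑' n, |c n| := fun k => by
    have h := tsum_of_norm_bounded hcs.hasSum (hle k)
    rw [(hsucc k).tsum_eq, Real.norm_eq_abs] at h
    have h1 := abs_sub_abs_le_abs_sub (avgLogZ N p β (k + 1) - avgLogZ N p β k)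
      (Real.log (Real.cosh β))
    rw [abs_sub_comm _ (Real.log (Real.cosh β))] at h1
    linarith
  have hd := (hasDerivAt_tsum_pois_mul (abs_le_mul_two_pow hbound) (γ * N)).comp γ
    ((hasDerivAt_id γ).mul_const (N : ℝ))
  have hd' := hd.const_mul (N : ℝ)⁻¹
  refine hd'.congr_deriv ?_
  have hswap : Summable (Function.uncurry fun k n =>
      pois (γ * N) k * (c n * avgOverlap N p β (n + 1) p k)) := by
    refine .of_norm_bounded ((hasSum_pois (γ * N)).summable.mul_of_nonneg hcs hP
      fun n => abs_nonneg _) fun ⟨k, n⟩ => ?_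
    simp only [Function.uncurry_apply_pair, norm_mul, Real.norm_of_nonneg (hP k)]
    exact mul_le_mul_of_nonneg_left ((norm_mul _ _).symm.trans_le (hle k n)) (hP k)
  have hq : ∀ n, c n * qPowAvg N p γ β (n + 1) p =
      ∑' k, pois (γ * N) k * (c n * avgOverlap N p β (n + 1) p k) := fun n => by
    rw [qPowAvg, Equench, ← tsum_mul_left]
    exact tsum_congr fun k => mul_left_comm _ _ _
  have hinner : ∀ k, ∑' n, pois (γ * N) k * (c n * avgOverlap N p β (n + 1) p k) =
      pois (γ * N) k * Real.log (Real.cosh β) -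
        pois (γ * N) k * (avgLogZ N p β (k + 1) - avgLogZ N p β k) := fun k => by
    rw [tsum_mul_left, (hsucc k).tsum_eq, mul_sub]
  have hPlog := (hasSum_pois (γ * N)).mul_right (Real.log (Real.cosh β))
  have hPdiff : Summable fun k =>
      pois (γ * N) k * (avgLogZ N p β (k + 1) - avgLogZ N p β k) := by
    refine .of_norm_bounded ((hasSum_pois (γ * N)).summable.mul_right
      (|Real.log (Real.cosh β)| + ∑' n, |c n|)) fun k => ?_
    rw [norm_mul, Real.norm_of_nonneg (hP k)]
    exact mul_le_mul_of_nonneg_left (hbound k) (hP k)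
  rw [tsum_congr hq, hswap.tsum_comm, tsum_congr hinner, hPlog.summable.tsum_sub hPdiff,
    hPlog.tsum_eq]
  field_simp
  ring

/-- `α`-streaming of the quenched pressure of the diluted Curie–Weiss model (`p = 2`,
`γ = α`): `∂_α A_N(α,β) = ln cosh β - ∑_{n≥1} ((-1)^n/n) θ^n ⟨q_{1…n}²⟩_N`,
with `θ = tanh β`, the series being absolutely convergent. -/
theorem pressure_alpha_derivative (N : ℕ) (hN : 0 < N) (α β : ℝ) (hα : 0 < α) (hβ : 0 < β) :
    Summable (fun n : ℕ =>
      |((-1 : ℝ) ^ (n + 1) / ((n : ℝ) + 1)) * Real.tanh β ^ (n + 1) *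
        qPowAvg N 2 α β (n + 1) 2|) ∧
    HasDerivAt (fun a : ℝ => pressure N 2 a β)
      (Real.log (Real.cosh β) -
        ∑' n : ℕ, ((-1 : ℝ) ^ (n + 1) / ((n : ℝ) + 1)) * Real.tanh β ^ (n + 1) *
          qPowAvg N 2 α β (n + 1) 2) α := by
  exact pressure_hasDerivAt hN 2 hα.le β
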